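/- Let N be a nonnegative integer and let ν ∈ ℂ satisfy 2ν + t ≠ 0 for every integer t with 0 ≤ t ≤ 2N. Then Σ_{ℓ=0}^{N} binom(N,ℓ) · ((2ν+2ℓ)/(2ν+ℓ)_{N+1}) = 1/(ν+1/2)_N. -/

import Mathlib

open scoped BigOperators

noncomputable section

/-- Ascending Pochhammer symbol `(a)_n = a (a+1) ⋯ (a+n-1)`. -/
def aP (n : ℕ) (a : ℂ) : ℂ := (ascPochhammer ℂ n).eval a

theorem aP_succ (n : ℕ) (a : ℂ) : aP (n + 1) a = aP n a * (a + n) :=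
  ascPochhammer_succ_eval n a

theorem aP_succ_left (n : ℕ) (a : ℂ) : aP (n + 1) a = a * aP n (a + 1) := by
  simp [aP, ascPochhammer_succ_left]

theorem aP_ne_zero {n : ℕ} {a : ℂ} (h : ∀ k < n, a + (k : ℂ) ≠ 0) : aP n a ≠ 0 := by
  induction n with
  | zero => simp [aP]
  | succ n ih =>
    rw [aP_succ]
    exact mul_ne_zero (ih fun k hk => h k (by omega)) (h n (by omega))

/-- The antidifference in the Gosper-type recurrence for the summand of
`pochhammer_binomial_sum`. -/
def pochhammerCertificate (N : ℕ) (a : ℂ) (l : ℕ) : ℂ :=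
  (1 - a - 2 * l) * (((N + 1).choose l : ℂ) - N.choose l) / aP (N + 1) (a + l)

theorem pochhammerCertificate_sub {N l : ℕ} {a : ℂ} (hl : l ≤ N + 1)
    (hT : aP (N + 2) (a + l) ≠ 0) :
    (a + 2 * N + 1) * (((N + 1).choose l : ℂ) * ((a + 2 * l) / aP (N + 2) (a + l))) -
        2 * ((N.choose l : ℂ) * ((a + 2 * l) / aP (N + 1) (a + l))) =
      pochhammerCertificate N a (l + 1) - pochhammerCertificate N a l := by
  have hright := aP_succ (N + 1) (a + l)
  have hleft := aP_succ_left (N + 1) (a + l)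
  have hchoose : ((N + 1).choose l : ℂ) * (N + 1 - l) = N.choose l * (N + 1) := by
    have h := Nat.choose_mul_succ_eq N l
    have h' : (N.choose l : ℂ) * ((N + 1 : ℕ) : ℂ) = (N + 1).choose l * ((N + 1 - l : ℕ) : ℂ) := by
      exact_mod_cast h
    rw [Nat.cast_sub hl] at h'
    push_cast at h'
    exact h'.symm
  have hpascal : (((N + 1).choose (l + 1) : ℕ) : ℂ) - N.choose (l + 1) = N.choose l := by
    rw [Nat.choose_succ_succ]
    push_cast
    ring
  have hcast : a + ((l + 1 : ℕ) : ℂ) = a + l + 1 := by push_cast; ring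
  rw [pochhammerCertificate, pochhammerCertificate, hpascal, hcast]
  rw [show N + 1 + 1 = N + 2 from rfl] at hright hleft
  push_cast at hright ⊢
  have hr : aP (N + 1) (a + l) ≠ 0 ∧ a + l + (N + 1) ≠ 0 := by
    rw [hright] at hT; exact mul_ne_zero_iff.mp hT
  have hs : a + l ≠ 0 ∧ aP (N + 1) (a + l + 1) ≠ 0 := by
    rw [hleft] at hT; exact mul_ne_zero_iff.mp hT
  have hP : (aP (N + 1) (a + l))⁻¹ = (a + l + (N + 1)) * (aP (N + 2) (a + l))⁻¹ := by
    rw [hright, mul_inv]; field_simp [hr.1, hr.2]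
  have hQ : (aP (N + 1) (a + l + 1))⁻¹ = (a + l) * (aP (N + 2) (a + l))⁻¹ := by
    rw [hleft, mul_inv]; field_simp [hs.1, hs.2]
  simp only [div_eq_mul_inv, hP, hQ]
  linear_combination (2 * l + a + 1) * (aP (N + 2) (a + l))⁻¹ * hchoose

theorem sum_choose_mul_div_aP_succ {N : ℕ} {a : ℂ}
    (ha : ∀ t : ℕ, t ≤ 2 * (N + 1) → a + (t : ℂ) ≠ 0) :
    (a + 2 * N + 1) * ∑ l ∈ Finset.range (N + 2),
        ((N + 1).choose l : ℂ) * ((a + 2 * l) / aP (N + 2) (a + l)) =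
      2 * ∑ l ∈ Finset.range (N + 1),
        (N.choose l : ℂ) * ((a + 2 * l) / aP (N + 1) (a + l)) := by
  have hlast : ∑ l ∈ Finset.range (N + 1),
        (N.choose l : ℂ) * ((a + 2 * l) / aP (N + 1) (a + l)) =
      ∑ l ∈ Finset.range (N + 2),
        (N.choose l : ℂ) * ((a + 2 * l) / aP (N + 1) (a + l)) := by
    rw [Finset.sum_range_succ _ (N + 1), Nat.choose_succ_self]
    simp
  rw [hlast, ← sub_eq_zero, Finset.mul_sum, Finset.mul_sum, ← Finset.sum_sub_distrib]
  have hterm : ∀ l ∈ Finset.range (N + 2), _ = _ := fun l hl =>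
    pochhammerCertificate_sub (N := N) (a := a) (l := l)
      (by rw [Finset.mem_range] at hl; omega)
      (aP_ne_zero fun k hk => by
        rw [Finset.mem_range] at hl
        have h := ha (l + k) (by omega)
        push_cast at h
        rwa [← add_assoc] at h)
  rw [Finset.sum_congr rfl hterm, Finset.sum_range_sub]
  simp [pochhammerCertificate, Nat.choose_eq_zero_of_lt]

/-- A Pochhammer summation identity. -/
theorem pochhammer_binomial_sum (N : ℕ) (ν : ℂ)
    (hν : ∀ t : ℕ, t ≤ 2 * N → 2 * ν + (t : ℂ) ≠ 0) :
    ∑ ℓ ∈ Finset.range (N + 1),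
        (N.choose ℓ : ℂ) * ((2 * ν + 2 * ℓ) / aP (N + 1) (2 * ν + ℓ)) =
      1 / aP N (ν + 1 / 2) := by
  induction N with
  | zero =>
    have h := hν 0 le_rfl
    have h' : ν ≠ 0 := by simpa using h
    simp [aP, h']
  | succ N ih =>
    have hrec := sum_choose_mul_div_aP_succ hν
    rw [ih fun t ht => hν t (by omega)] at hrec
    have h := hν (2 * N + 1) (by omega)
    push_cast at h
    have h₁ : 2 * ν + 2 * N + 1 ≠ 0 := by rwa [← add_assoc] at h
    have h₂ : ν + 1 / 2 + N = (2 * ν + 2 * N + 1) / 2 := by ring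
    apply mul_left_cancel₀ h₁
    rw [hrec, aP_succ, h₂]
    simp only [div_eq_mul_inv, mul_inv, inv_inv]
    linear_combination (-2 * (aP N (ν + 1 * 2⁻¹))⁻¹) * mul_inv_cancel₀ h₁
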